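/- arXiv:1805.02254 — 2 statements merged into one kernel-verified Lean document; each statement's English description precedes it below -/
import Mathlib

section
/- Let φ : ℝ → ℝ be a continuous mapping whose set of nonlinearity E(φ) has nonzero Lebesgue measure, let N ≥ 4 be an integer, and let M ⊂ ℝ be a finite set with distinct sums of pairs. Then there exists an arithmetic progression A of length N such that: (a) φ restricted to A is injective; (b) φ(A) ∩ M = ∅; and (c) φ(A) ∪ M is a set with distinct sums of pairs. -/
open MeasureTheory Set

/-- A set `E ⊆ ℝ` has distinct sums of pairs. -/
def DistinctSumsOfPairs (E : Set ℝ) : Prop :=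
  ∀ l₁ ∈ E, ∀ l₂ ∈ E, ∀ l₃ ∈ E, ∀ l₄ ∈ E,
    l₁ + l₂ = l₃ + l₄ → (l₁ = l₃ ∧ l₂ = l₄) ∨ (l₁ = l₄ ∧ l₂ = l₃)

/-- The set of nonlinearity of `φ`: points having no open neighborhood
on which `φ` coincides with an affine function. -/
def NonlinSet (φ : ℝ → ℝ) : Set ℝ :=
  {t | ¬ ∃ ε > (0 : ℝ), ∃ p q : ℝ, ∀ u : ℝ, |u - t| < ε → φ u = p * u + q}

/-- The linear combination of values of `φ` along the progression. -/
def relSum (φ : ℝ → ℝ) (N : ℕ) (c : ℕ → ℝ) (x y : ℝ) : ℝ :=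
  ∑ i ∈ Finset.Icc 1 N, c i * φ (x + (i : ℝ) * y)

lemma relSum_continuous {φ : ℝ → ℝ} (hφ : Continuous φ) (N : ℕ) (c : ℕ → ℝ) :
    Continuous (fun p : ℝ × ℝ => relSum φ N c p.1 p.2) := by
  unfold relSum
  fun_prop

lemma avoid_finite {ι : Type*} (F : ι → Set (ℝ × ℝ)) (R : Set ι) (hR : R.Finite)
    (hF : ∀ r ∈ R, IsClosed (F r)) :
    ∀ (U : Set (ℝ × ℝ)), IsOpen U → U.Nonempty →
    (∀ r ∈ R, ∀ V : Set (ℝ × ℝ), IsOpen V → V.Nonempty → V ⊆ U → ¬ V ⊆ F r) →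
    ∃ p ∈ U, ∀ r ∈ R, p ∉ F r := by
  induction R, hR using Set.Finite.induction_on with
  | empty =>
    intro U _ hne _
    obtain ⟨p, hp⟩ := hne
    exact ⟨p, hp, by simp⟩
  | @insert a s has hs ih =>
    intro U hU hne h
    have h1 := h a (by simp) U hU hne le_rfl
    obtain ⟨p, hp, hpF⟩ := Set.not_subset.1 h1
    obtain ⟨q, hq, hq'⟩ := ih (fun r hr => hF r (by simp [hr])) (U \ F a)
      (hU.sdiff (hF a (by simp))) ⟨p, hp, hpF⟩
      (fun r hr V hV hVn hVU => h r (by simp [hr]) V hV hVn (hVU.trans sdiff_subset))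
    refine ⟨q, hq.1, ?_⟩
    rintro r (rfl | hr)
    · exact hq.2
    · exact hq' r hr

lemma grid_quad (f : ℕ → ℝ) (K : ℕ)
    (h : ∀ n, n + 3 ≤ K → f (n + 3) - 3 * f (n + 2) + 3 * f (n + 1) - f n = 0) :
    ∀ n ≤ K, f n = f 0 + (f 1 - f 0) * n + (f 2 - 2 * f 1 + f 0) * (n * (n - 1) / 2) := by
  intro n
  induction n using Nat.strong_induction_on with
  | _ n ih =>
    intro hn
    match n, ih, hn with
    | 0, _, _ => simp
    | 1, _, _ => simp
    | 2, _, _ => push_cast; ring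
    | n + 3, ih, hn =>
      have e := h n hn
      have e0 := ih n (by omega) (by omega)
      have e1 := ih (n + 1) (by omega) (by omega)
      have e2 := ih (n + 2) (by omega) (by omega)
      push_cast at *
      have : f (n + 3) = 3 * f (n + 2) - 3 * f (n + 1) + f n := by linarith
      rw [this, e2, e1, e0]
      ring

lemma quad_zero (g : ℝ → ℝ) (hg : Continuous g)
    (h : ∀ s u : ℝ, 0 ≤ s → 0 < u → s + 3 * u ≤ 1 →
      g (s + 3 * u) - 3 * g (s + 2 * u) + 3 * g (s + u) - g s = 0)
    (h0 : g 0 = 0) (h1 : g (1 / 2) = 0) (h2 : g 1 = 0) :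
    ∀ s, 0 ≤ s → s ≤ 1 → g s = 0 := by
  have key : ∀ K : ℕ, 1 ≤ K → ∀ n ≤ 2 * K, g ((n : ℝ) / (2 * K : ℕ)) = 0 := by
    intro K hK n hn
    have hK' : (1 : ℝ) ≤ K := by exact_mod_cast hK
    have hK0 : (K : ℝ) ≠ 0 := by linarith
    set f : ℕ → ℝ := fun n => g ((n : ℝ) / (2 * K : ℕ)) with hf
    have hq := grid_quad f (2 * K) (by
      intro n hn
      have hn' : (n : ℝ) + 3 ≤ 2 * K := by exact_mod_cast hn
      have := h ((n : ℝ) / (2 * K : ℕ)) (1 / (2 * K : ℕ)) (by positivity) (by positivity) (by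
        push_cast
        rw [← mul_div_assoc, ← add_div, div_le_one (by linarith)]
        linarith)
      simp only [hf]
      convert this using 5 <;> (try push_cast) <;> (try ring_nf))
    have f0 : f 0 = 0 := by simp [hf, h0]
    have fK : f K = 0 := by
      simp only [hf]; push_cast
      rw [show (K : ℝ) / (2 * K) = 1 / 2 by field_simp]; exact h1
    have f2K : f (2 * K) = 0 := by
      simp only [hf]
      rw [div_self (by push_cast; positivity)]; exact h2
    have e1 := hq K (by omega)
    have e2 := hq (2 * K) le_rfl
    rw [f0, fK] at e1
    rw [f0, f2K] at e2
    push_cast at e1 e2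
    have hc : f 2 - 2 * f 1 + 0 = 0 := by
      have : (f 2 - 2 * f 1 + 0) * (K * K) = 0 := by nlinarith
      simpa [hK0] using this
    rw [hc] at e1
    have hb : f 1 - 0 = 0 := by
      have : (f 1 - 0) * K = 0 := by linarith
      simpa [hK0] using this
    have := hq n hn
    rw [f0, hb, hc] at this
    rw [show g ((n : ℝ) / (2 * K : ℕ)) = f n from rfl, this]
    ring
  intro s hs0 hs1
  have ht : Filter.Tendsto (fun K : ℕ => ((⌊s * ((2 * K : ℕ) : ℝ)⌋₊ : ℝ)) / ((2 * K : ℕ) : ℝ))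
      Filter.atTop (nhds s) := by
    have h1 := tendsto_nat_floor_mul_div_atTop (R := ℝ) hs0
    have h2 : Filter.Tendsto (fun K : ℕ => ((2 * K : ℕ) : ℝ)) Filter.atTop Filter.atTop := by
      apply tendsto_natCast_atTop_atTop.comp
      exact Filter.tendsto_id.const_mul_atTop' (by norm_num)
    exact h1.comp h2
  have ht2 := (hg.tendsto s).comp ht
  have ht3 : Filter.Tendsto (fun _ : ℕ => (0 : ℝ)) Filter.atTop (nhds (g s)) := by
    refine ht2.congr' ?_
    filter_upwards [Filter.eventually_ge_atTop 1] with K hK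
    refine key K hK _ ?_
    have : s * ((2 * K : ℕ) : ℝ) ≤ ((2 * K : ℕ) : ℝ) := by
      have : (0 : ℝ) ≤ ((2 * K : ℕ) : ℝ) := by positivity
      nlinarith
    exact (Nat.floor_le_floor this).trans (by rw [Nat.floor_natCast])
  exact (tendsto_nhds_unique ht3 tendsto_const_nhds)

lemma quad_unit (g : ℝ → ℝ) (hg : Continuous g)
    (h : ∀ s u : ℝ, 0 ≤ s → 0 < u → s + 3 * u ≤ 1 →
      g (s + 3 * u) - 3 * g (s + 2 * u) + 3 * g (s + u) - g s = 0) :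
    ∃ A B C : ℝ, ∀ s, 0 ≤ s → s ≤ 1 → g s = A * s ^ 2 + B * s + C := by
  refine ⟨2 * g 1 - 4 * g (1 / 2) + 2 * g 0, 4 * g (1 / 2) - g 1 - 3 * g 0, g 0, ?_⟩
  set A := 2 * g 1 - 4 * g (1 / 2) + 2 * g 0 with hA
  set B := 4 * g (1 / 2) - g 1 - 3 * g 0 with hB
  have := quad_zero (fun s => g s - (A * s ^ 2 + B * s + g 0)) (by fun_prop) (by
      intro s u hs hu hsu
      have := h s u hs hu hsu
      linear_combination this) (by simp) (by simp only [hA, hB]; ring)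
      (by simp only [hA, hB]; ring)
  intro s h0 h1
  have := this s h0 h1
  linarith

/-- Vanishing third differences imply quadratic. -/
lemma quad_of_diff (φ : ℝ → ℝ) (hφ : Continuous φ) (a δ : ℝ) (hδ : 0 < δ)
    (h : ∀ t u : ℝ, |t - a| < δ → |u| < δ →
      φ (t + 3 * u) - 3 * φ (t + 2 * u) + 3 * φ (t + u) - φ t = 0) :
    ∃ A B C : ℝ, ∀ t, a ≤ t → t ≤ a + δ → φ t = A * t ^ 2 + B * t + C := by
  obtain ⟨A, B, C, hq⟩ := quad_unit (fun s => φ (a + δ * s)) (by fun_prop) (by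
    intro s u hs hu hsu
    have := h (a + δ * s) (δ * u) (by
      rw [add_sub_cancel_left, abs_of_nonneg (by positivity)]; nlinarith) (by
      rw [abs_of_nonneg (by positivity)]; nlinarith)
    rw [← this]
    ring_nf)
  refine ⟨A / δ ^ 2, B / δ - 2 * A * a / δ ^ 2, C + A * a ^ 2 / δ ^ 2 - B * a / δ, ?_⟩
  intro t h0 h1
  have := hq ((t - a) / δ) (div_nonneg (by linarith) hδ.le) (by rw [div_le_one hδ]; linarith)
  rw [show a + δ * ((t - a) / δ) = t by field_simp; ring] at this
  rw [this]
  field_simp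
  ring

lemma diff_zero_of_rel (φ : ℝ → ℝ) (N : ℕ) (c : ℕ → ℝ) (m x₀ y₀ δ : ℝ)
    (hδ : 0 < δ) (k j₁ j₂ j₃ : ℕ) (hkN : k ∈ Finset.Icc 1 N) (hk : c k ≠ 0)
    (h1 : j₁ ≠ k) (h2 : j₂ ≠ k) (h3 : j₃ ≠ k)
    (hs : ∀ i, c i ≠ 0 → i = k ∨ i = j₁ ∨ i = j₂ ∨ i = j₃)
    (h : ∀ x y, |x - x₀| < δ → |y - y₀| < δ → relSum φ N c x y = m) :
    ∃ ε > 0, ∀ t u : ℝ, |t - (x₀ + k * y₀)| < ε → |u| < ε →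
      φ (t + 3 * u) - 3 * φ (t + 2 * u) + 3 * φ (t + u) - φ t = 0 := by
  have hd1 : (k : ℝ) - j₁ ≠ 0 := sub_ne_zero.2 (by exact_mod_cast h1.symm)
  have hd2 : (k : ℝ) - j₂ ≠ 0 := sub_ne_zero.2 (by exact_mod_cast h2.symm)
  have hd3 : (k : ℝ) - j₃ ≠ 0 := sub_ne_zero.2 (by exact_mod_cast h3.symm)
  set a := x₀ + k * y₀ with ha
  -- evaluation points
  let X : ℝ → ℝ → ℝ → ℝ → ℝ → ℝ := fun t u e₁ e₂ e₃ =>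
    x₀ + (t - a) - (e₁ * j₁ / (k - j₁) + e₂ * j₂ / (k - j₂) + e₃ * j₃ / (k - j₃)) * u
  let Y : ℝ → ℝ → ℝ → ℝ → ℝ := fun u e₁ e₂ e₃ =>
    y₀ + (e₁ / (k - j₁) + e₂ / (k - j₂) + e₃ / (k - j₃)) * u
  have hev : ∀ e₁ e₂ e₃ : ℝ, ∀ᶠ p : ℝ × ℝ in nhds (a, 0),
      relSum φ N c (X p.1 p.2 e₁ e₂ e₃) (Y p.2 e₁ e₂ e₃) = m := by
    intro e₁ e₂ e₃
    have c1 : Continuous (fun p : ℝ × ℝ => |X p.1 p.2 e₁ e₂ e₃ - x₀|) := by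
      simp only [X]; fun_prop
    have c2 : Continuous (fun p : ℝ × ℝ => |Y p.2 e₁ e₂ e₃ - y₀|) := by
      simp only [Y]; fun_prop
    have o1 := c1.continuousAt.eventually_lt (x₀ := ((a, 0) : ℝ × ℝ)) (g := fun _ => δ)
      continuousAt_const (by simpa [X] using hδ)
    have o2 := c2.continuousAt.eventually_lt (x₀ := ((a, 0) : ℝ × ℝ)) (g := fun _ => δ)
      continuousAt_const (by simpa [Y] using hδ)
    filter_upwards [o1, o2] with p hp1 hp2
    exact h _ _ hp1 hp2
  have hall := (hev 0 0 0).and <| (hev 1 0 0).and <| (hev 0 1 0).and <| (hev 0 0 1).and <|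
    (hev 1 1 0).and <| (hev 1 0 1).and <| (hev 0 1 1).and (hev 1 1 1)
  obtain ⟨ε, hε, hball⟩ := Metric.eventually_nhds_iff.1 hall
  refine ⟨ε, hε, ?_⟩
  intro t u ht hu
  obtain ⟨q0, q1, q2, q3, q4, q5, q6, q7⟩ := hball (y := (t, u)) (by
    rw [Prod.dist_eq]
    simp only [Real.dist_eq, sub_zero]
    exact max_lt ht hu)
  simp only at q0 q1 q2 q3 q4 q5 q6 q7
  have hsum : ∑ i ∈ Finset.Icc 1 N, c i * (
      φ (X t u 1 1 1 + i * Y u 1 1 1) - φ (X t u 1 1 0 + i * Y u 1 1 0)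
      - φ (X t u 1 0 1 + i * Y u 1 0 1) - φ (X t u 0 1 1 + i * Y u 0 1 1)
      + φ (X t u 1 0 0 + i * Y u 1 0 0) + φ (X t u 0 1 0 + i * Y u 0 1 0)
      + φ (X t u 0 0 1 + i * Y u 0 0 1) - φ (X t u 0 0 0 + i * Y u 0 0 0)) = 0 := by
    simp only [mul_sub, mul_add, Finset.sum_sub_distrib, Finset.sum_add_distrib]
    simp only [relSum] at q0 q1 q2 q3 q4 q5 q6 q7
    rw [q0, q1, q2, q3, q4, q5, q6, q7]
    ring
  have hP : ∀ (i : ℕ) (e₁ e₂ e₃ : ℝ), X t u e₁ e₂ e₃ + i * Y u e₁ e₂ e₃ =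
      x₀ + (t - a) + i * y₀ + (e₁ * ((i - j₁) / (k - j₁)) + e₂ * ((i - j₂) / (k - j₂))
        + e₃ * ((i - j₃) / (k - j₃))) * u := by
    intro i e₁ e₂ e₃
    simp only [X, Y]
    ring
  simp only [hP] at hsum
  rw [Finset.sum_eq_single_of_mem k hkN] at hsum
  · rw [div_self hd1, div_self hd2, div_self hd3] at hsum
    have := (mul_eq_zero.1 hsum).resolve_left hk
    have hb : x₀ + (t - a) + k * y₀ = t := by rw [ha]; ring
    rw [hb] at this
    norm_num at this
    linarith
  · intro i _ hik
    by_cases hci : c i = 0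
    · rw [hci, zero_mul]
    · rcases hs i hci with rfl | rfl | rfl | rfl
      · exact absurd rfl hik
      all_goals
        apply mul_eq_zero_of_right
        simp only [sub_self, zero_div, mul_zero, zero_add, add_zero, zero_mul, one_mul]
        ring_nf

lemma quad_of_rel (φ : ℝ → ℝ) (hφ : Continuous φ) (N : ℕ) (c : ℕ → ℝ) (m x₀ y₀ δ : ℝ)
    (hδ : 0 < δ) (hc : ∃ k ∈ Finset.Icc 1 N, c k ≠ 0)
    (hs : ∃ i₁ i₂ i₃ i₄ : ℕ, ∀ i, c i ≠ 0 → i = i₁ ∨ i = i₂ ∨ i = i₃ ∨ i = i₄)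
    (h : ∀ x y, |x - x₀| < δ → |y - y₀| < δ → relSum φ N c x y = m) :
    ∃ k ∈ Finset.Icc 1 N, ∃ ε > 0, ∃ A B C : ℝ,
      ∀ t, x₀ + k * y₀ ≤ t → t ≤ x₀ + k * y₀ + ε → φ t = A * t ^ 2 + B * t + C := by
  obtain ⟨k, hkN, hk⟩ := hc
  obtain ⟨i₁, i₂, i₃, i₄, hs⟩ := hs
  have : ∃ j₁ j₂ j₃ : ℕ, j₁ ≠ k ∧ j₂ ≠ k ∧ j₃ ≠ k ∧
      ∀ i, c i ≠ 0 → i = k ∨ i = j₁ ∨ i = j₂ ∨ i = j₃ := by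
    have hfix : ∀ n : ℕ, ∃ j, j ≠ k ∧ ∀ i, i = n → i = k ∨ i = j := by
      intro n
      by_cases hn : n = k
      · exact ⟨k + 1, by omega, fun i hi => Or.inl (hi.trans hn)⟩
      · exact ⟨n, hn, fun i hi => Or.inr hi⟩
    obtain ⟨b1, hb1, hb1'⟩ := hfix i₁
    obtain ⟨b2, hb2, hb2'⟩ := hfix i₂
    obtain ⟨b3, hb3, hb3'⟩ := hfix i₃
    obtain ⟨b4, hb4, hb4'⟩ := hfix i₄
    rcases hs k hk with e | e | e | e
    · refine ⟨b2, b3, b4, hb2, hb3, hb4, fun i hi => ?_⟩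
      have := hs i hi; have := hb2' i; have := hb3' i; have := hb4' i
      grind
    · refine ⟨b1, b3, b4, hb1, hb3, hb4, fun i hi => ?_⟩
      have := hs i hi; have := hb1' i; have := hb3' i; have := hb4' i
      grind
    · refine ⟨b1, b2, b4, hb1, hb2, hb4, fun i hi => ?_⟩
      have := hs i hi; have := hb2' i; have := hb1' i; have := hb4' i
      grind
    · refine ⟨b1, b2, b3, hb1, hb2, hb3, fun i hi => ?_⟩
      have := hs i hi; have := hb2' i; have := hb3' i; have := hb1' i
      grind
  obtain ⟨j₁, j₂, j₃, h1, h2, h3, hs'⟩ := this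
  obtain ⟨ε, hε, hd⟩ := diff_zero_of_rel φ N c m x₀ y₀ δ hδ k j₁ j₂ j₃ hkN hk h1 h2 h3 hs' h
  obtain ⟨A, B, C, hq⟩ := quad_of_diff φ hφ _ ε hε hd
  exact ⟨k, hkN, ε, hε, A, B, C, hq⟩

/-- Points `(x, y)` with `y > 0` whose progression lies in an interval. -/
def apRegion (N : ℕ) (a b : ℝ) : Set (ℝ × ℝ) :=
  {p | 0 < p.2 ∧ ∀ k ∈ Finset.Icc 1 N, p.1 + (k : ℝ) * p.2 ∈ Ioo a b}

lemma apRegion_open (N : ℕ) (a b : ℝ) : IsOpen (apRegion N a b) := by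
  have : apRegion N a b = {p : ℝ × ℝ | 0 < p.2} ∩
      ⋂ k ∈ Finset.Icc 1 N, (fun p : ℝ × ℝ => p.1 + (k : ℝ) * p.2) ⁻¹' Ioo a b := by
    ext p; simp [apRegion]
  rw [this]
  refine (isOpen_lt continuous_const continuous_snd).inter ?_
  exact isOpen_biInter_finset fun k _ => isOpen_Ioo.preimage (by fun_prop)

lemma apRegion_nonempty (N : ℕ) (a b : ℝ) (hab : a < b) : (apRegion N a b).Nonempty := by
  refine ⟨(a, (b - a) / (N + 1)), ?_, ?_⟩
  · have : 0 < b - a := by linarith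
    simp only; positivity
  · intro k hk
    have hk := Finset.mem_Icc.1 hk
    have k1 : (1 : ℝ) ≤ k := by exact_mod_cast hk.1
    have k2 : (k : ℝ) ≤ N := by exact_mod_cast hk.2
    have hba : 0 < b - a := by linarith
    have hN : (0 : ℝ) < N + 1 := by linarith
    constructor
    · have : 0 < (k : ℝ) * ((b - a) / (N + 1)) := by positivity
      simp only; linarith
    · have : (k : ℝ) * ((b - a) / (N + 1)) < b - a := by
        rw [← mul_div_assoc, div_lt_iff₀ hN]; nlinarith
      simp only; linarith

/-- The relations that are to be avoided. -/
structure GoodRel (N : ℕ) (c : ℕ → ℝ) : Prop where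
  mom : ∑ i ∈ Finset.Icc 1 N, c i ≠ 0 ∨ ∑ i ∈ Finset.Icc 1 N, c i * i ≠ 0 ∨
    ∑ i ∈ Finset.Icc 1 N, c i * (i : ℝ) ^ 2 ≠ 0
  supp : ∃ i₁ i₂ i₃ i₄ : ℕ, ∀ i, c i ≠ 0 → i = i₁ ∨ i = i₂ ∨ i = i₃ ∨ i = i₄

lemma GoodRel.exists_ne {N : ℕ} {c : ℕ → ℝ} (h : GoodRel N c) :
    ∃ k ∈ Finset.Icc 1 N, c k ≠ 0 := by
  by_contra! hc
  rcases h.mom with h | h | h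
  · exact h (Finset.sum_eq_zero hc)
  · exact h (Finset.sum_eq_zero fun i hi => by rw [hc i hi, zero_mul])
  · exact h (Finset.sum_eq_zero fun i hi => by rw [hc i hi, zero_mul])

lemma exists_box {V : Set (ℝ × ℝ)} (hV : IsOpen V) (hne : V.Nonempty) :
    ∃ x₀ y₀ δ : ℝ, 0 < δ ∧ (x₀, y₀) ∈ V ∧
      ∀ x y, |x - x₀| < δ → |y - y₀| < δ → (x, y) ∈ V := by
  obtain ⟨⟨x₀, y₀⟩, hp⟩ := hne
  obtain ⟨δ, hδ, hb⟩ := Metric.isOpen_iff.1 hV _ hp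
  refine ⟨x₀, y₀, δ, hδ, hp, fun x y hx hy => hb ?_⟩
  rw [Metric.mem_ball, Prod.dist_eq]
  simp only [Real.dist_eq]
  exact max_lt hx hy

lemma case_quad (φ : ℝ → ℝ) (hφ : Continuous φ) (N : ℕ) (R : Set ((ℕ → ℝ) × ℝ))
    (hR : R.Finite) (hgood : ∀ r ∈ R, GoodRel N r.1) (a b : ℝ) (hab : a < b)
    (A B C : ℝ) (hA : A ≠ 0) (hq : ∀ t ∈ Ioo a b, φ t = A * t ^ 2 + B * t + C) :
    ∃ x y : ℝ, y ≠ 0 ∧ ∀ r ∈ R, relSum φ N r.1 x y ≠ r.2 := by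
  obtain ⟨p, hp, hp'⟩ := avoid_finite (fun r : (ℕ → ℝ) × ℝ => {p : ℝ × ℝ | relSum φ N r.1 p.1 p.2 = r.2})
    R hR (fun r _ => isClosed_eq (relSum_continuous hφ N r.1) continuous_const)
    (apRegion N a b) (apRegion_open N a b) (apRegion_nonempty N a b hab) (by
    intro r hr V hV hVn hVU hVF
    obtain ⟨x₀, y₀, δ, hδ, hmem, hbox⟩ := exists_box hV hVn
    set C0 := ∑ i ∈ Finset.Icc 1 N, r.1 i with hC0
    set C1 := ∑ i ∈ Finset.Icc 1 N, r.1 i * i with hC1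
    set C2 := ∑ i ∈ Finset.Icc 1 N, r.1 i * (i : ℝ) ^ 2 with hC2
    have hval : ∀ x y, |x - x₀| < δ → |y - y₀| < δ →
        A * x ^ 2 * C0 + 2 * A * x * y * C1 + A * y ^ 2 * C2 + B * x * C0 + B * y * C1 + C * C0
          = r.2 := by
      intro x y hx hy
      have hV' := hbox x y hx hy
      have e : relSum φ N r.1 x y = r.2 := hVF hV'
      have hU := (hVU hV').2
      rw [← e, relSum, hC0, hC1, hC2]
      simp only [Finset.mul_sum, ← Finset.sum_add_distrib]
      refine Finset.sum_congr rfl fun i hi => ?_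
      rw [hq _ (hU i hi)]
      simp only
      ring
    set η := δ / 2 with hη
    have hη0 : 0 < η := by positivity
    have hηδ : η < δ := by rw [hη]; linarith
    have z : |x₀ - x₀| < δ := by simpa using hδ
    have z' : |y₀ - y₀| < δ := by simpa using hδ
    have xp : |x₀ + η - x₀| < δ := by rw [add_sub_cancel_left, abs_of_pos hη0]; exact hηδ
    have xm : |x₀ - η - x₀| < δ := by
      rw [show x₀ - η - x₀ = -η by ring, abs_neg, abs_of_pos hη0]; exact hηδ
    have yp : |y₀ + η - y₀| < δ := by rw [add_sub_cancel_left, abs_of_pos hη0]; exact hηδ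
    have ym : |y₀ - η - y₀| < δ := by
      rw [show y₀ - η - y₀ = -η by ring, abs_neg, abs_of_pos hη0]; exact hηδ
    have e0 := hval _ _ z z'
    have e1 := hval _ _ xp z'
    have e2 := hval _ _ xm z'
    have e3 := hval _ _ z yp
    have e4 := hval _ _ z ym
    have e5 := hval _ _ xp yp
    have f0 : A * η ^ 2 * C0 = 0 := by linear_combination (e1 + e2 - 2 * e0) / 2
    have f2 : A * η ^ 2 * C2 = 0 := by linear_combination (e3 + e4 - 2 * e0) / 2
    have f1 : A * η ^ 2 * C1 = 0 := by linear_combination (e5 - e1 - e3 + e0) / 2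
    have hne : A * η ^ 2 ≠ 0 := by positivity
    rcases (hgood r hr).mom with h | h | h
    · exact h ((mul_eq_zero.1 f0).resolve_left hne)
    · exact h ((mul_eq_zero.1 f1).resolve_left hne)
    · exact h ((mul_eq_zero.1 f2).resolve_left hne))
  exact ⟨p.1, p.2, hp.1.ne', hp'⟩

lemma case_interior (φ : ℝ → ℝ) (hφ : Continuous φ) (N : ℕ) (R : Set ((ℕ → ℝ) × ℝ))
    (hR : R.Finite) (hgood : ∀ r ∈ R, GoodRel N r.1) (a b : ℝ) (hab : a < b)
    (hsub : Ioo a b ⊆ NonlinSet φ) :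
    ∃ x y : ℝ, y ≠ 0 ∧ ∀ r ∈ R, relSum φ N r.1 x y ≠ r.2 := by
  by_cases hquad : ∃ a b : ℝ, a < b ∧ ∃ A B C : ℝ, A ≠ 0 ∧ ∀ t ∈ Ioo a b, φ t = A * t ^ 2 + B * t + C
  · obtain ⟨a, b, hab, A, B, C, hA, hq⟩ := hquad
    exact case_quad φ hφ N R hR hgood a b hab A B C hA hq
  obtain ⟨p, hp, hp'⟩ := avoid_finite (fun r : (ℕ → ℝ) × ℝ => {p : ℝ × ℝ | relSum φ N r.1 p.1 p.2 = r.2})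
    R hR (fun r _ => isClosed_eq (relSum_continuous hφ N r.1) continuous_const)
    (apRegion N a b) (apRegion_open N a b) (apRegion_nonempty N a b hab) (by
    intro r hr V hV hVn hVU hVF
    obtain ⟨x₀, y₀, δ, hδ, hmem, hbox⟩ := exists_box hV hVn
    obtain ⟨k, hk, ε, hε, A, B, C, hq⟩ := quad_of_rel φ hφ N r.1 r.2 x₀ y₀ δ hδ
      (hgood r hr).exists_ne (hgood r hr).supp (fun x y hx hy => hVF (hbox x y hx hy))
    have hk' := (hVU hmem).2 k hk
    simp only at hk'
    set t₀ := x₀ + (k : ℝ) * y₀ with ht₀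
    by_cases hA : A = 0
    · obtain ⟨s, hs1, hs2⟩ := exists_between (lt_min (show t₀ < t₀ + ε by linarith) hk'.2)
      have hs3 := lt_min_iff.1 hs2
      apply hsub (show s ∈ Ioo a b from ⟨hk'.1.trans hs1, hs3.2⟩)
      refine ⟨min (s - t₀) (t₀ + ε - s), lt_min (by linarith) (by linarith), B, C, ?_⟩
      intro u hu
      have hu := abs_lt.1 hu
      have m1 := min_le_left (s - t₀) (t₀ + ε - s)
      have m2 := min_le_right (s - t₀) (t₀ + ε - s)
      rw [hq u (by linarith) (by linarith), hA]
      ring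
    · exact hquad ⟨t₀, t₀ + ε, by linarith, A, B, C, hA, fun t ht => hq t ht.1.le ht.2.le⟩)
  exact ⟨p.1, p.2, hp.1.ne', hp'⟩

lemma nonlin_closed (φ : ℝ → ℝ) : IsClosed (NonlinSet φ) := by
  rw [← isOpen_compl_iff, Metric.isOpen_iff]
  intro t ht
  simp only [NonlinSet, mem_compl_iff, mem_ofPred_eq, not_not] at ht
  obtain ⟨ε, hε, p, q, h⟩ := ht
  refine ⟨ε, hε, fun s hs => ?_⟩
  simp only [NonlinSet, mem_compl_iff, mem_ofPred_eq, not_not]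
  rw [Metric.mem_ball, Real.dist_eq] at hs
  refine ⟨ε - |s - t|, by linarith, p, q, fun u hu => h u ?_⟩
  have := abs_sub_le u s t
  linarith

/-- Being of full density at each of its points. -/
def FullDensity (D : Set ℝ) : Prop :=
  ∀ a ∈ D, ∀ ε > (0 : ℝ), ∀ᶠ r in nhdsWithin (0 : ℝ) (Ioi 0),
    volume (Metric.closedBall a r \ D) ≤ ENNReal.ofReal (ε * r)

lemma density_set (E : Set ℝ) (hE : IsClosed E) (hv : volume E ≠ 0) :
    ∃ D ⊆ E, D.Nonempty ∧ FullDensity D := by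
  have hae := Besicovitch.ae_tendsto_measure_inter_div (volume : Measure ℝ) E
  rw [ae_restrict_iff' hE.measurableSet] at hae
  set P : ℝ → Prop := fun x => Filter.Tendsto
    (fun r => volume (E ∩ Metric.closedBall x r) / volume (Metric.closedBall x r))
    (nhdsWithin 0 (Set.Ioi 0)) (nhds 1) with hP
  set D := {x | x ∈ E ∧ P x} with hD
  have hnull : volume (E \ D) = 0 := by
    refine measure_mono_null ?_ hae
    rintro x ⟨hx, hxD⟩
    simp only [mem_compl_iff, mem_ofPred_eq]
    intro h
    exact hxD ⟨hx, h hx⟩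
  refine ⟨D, fun x hx => hx.1, ?_, ?_⟩
  · by_contra hne
    rw [Set.not_nonempty_iff_eq_empty] at hne
    rw [hne, sdiff_empty] at hnull
    exact hv hnull
  · rintro a ⟨haE, haP⟩ ε hε
    have hlt : ENNReal.ofReal (1 - ε / 2) < 1 := by
      rw [← ENNReal.ofReal_one]
      exact (ENNReal.ofReal_lt_ofReal_iff one_pos).2 (by linarith)
    filter_upwards [haP.eventually_const_lt hlt, self_mem_nhdsWithin] with r hr hr0
    have hr0 : 0 < r := hr0
    have hB : volume (Metric.closedBall a r) = ENNReal.ofReal (2 * r) := Real.volume_closedBall a r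
    have h1 : ENNReal.ofReal (1 - ε / 2) * ENNReal.ofReal (2 * r) ≤
        volume (E ∩ Metric.closedBall a r) := by
      rw [hB] at hr
      exact (ENNReal.le_div_iff_mul_le (Or.inl (by simpa using hr0)) (Or.inl ENNReal.ofReal_ne_top)).1 hr.le
    have h2 : volume (Metric.closedBall a r \ D) ≤ volume (Metric.closedBall a r \ E) := by
      calc volume (Metric.closedBall a r \ D)
          ≤ volume ((Metric.closedBall a r \ E) ∪ (E \ D)) := by
            apply measure_mono
            rintro x ⟨hx, hxD⟩
            by_cases hxE : x ∈ E
            · exact Or.inr ⟨hxE, hxD⟩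
            · exact Or.inl ⟨hx, hxE⟩
        _ ≤ volume (Metric.closedBall a r \ E) + volume (E \ D) := measure_union_le _ _
        _ = _ := by rw [hnull, add_zero]
    refine h2.trans ?_
    have h3 := measure_inter_add_sdiff (μ := (volume : Measure ℝ)) (Metric.closedBall a r) hE.measurableSet
    rw [inter_comm, hB] at h3
    rcases le_or_gt (1 - ε / 2) 0 with hneg | hpos
    · calc volume (Metric.closedBall a r \ E) ≤ ENNReal.ofReal (2 * r) := by
            rw [← h3]; exact le_add_self
        _ ≤ _ := ENNReal.ofReal_le_ofReal (by nlinarith)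
    · have h4 : ENNReal.ofReal ((1 - ε / 2) * (2 * r)) + volume (Metric.closedBall a r \ E) ≤
          ENNReal.ofReal ((1 - ε / 2) * (2 * r)) + ENNReal.ofReal (ε * r) := by
        rw [← ENNReal.ofReal_add (by positivity) (by positivity),
          show (1 - ε / 2) * (2 * r) + ε * r = 2 * r by ring, ← h3]
        gcongr
        rw [ENNReal.ofReal_mul hpos.le]
        exact h1
      exact (ENNReal.add_le_add_iff_left ENNReal.ofReal_ne_top).1 h4

lemma infinite_steps (D : Set ℝ) (hD : FullDensity D) (N k : ℕ) (b₀ y₀ : ℝ)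
    (hmem : ∀ j ∈ Finset.Ioc k N, b₀ + ((j : ℝ) - k) * y₀ ∈ D) (ρ : ℝ) (hρ : 0 < ρ) :
    ∃ η > 0, η ≤ ρ ∧ ∀ b, |b - b₀| < η →
      {y | |y - y₀| < η ∧ ∀ j ∈ Finset.Ioc k N, b + ((j : ℝ) - k) * y ∈ D}.Infinite := by
  set ε : ℝ := 1 / ((N : ℝ) + 1) ^ 2 with hε
  have hε0 : 0 < ε := by positivity
  have hall : ∀ᶠ r in nhdsWithin (0 : ℝ) (Ioi 0), ∀ j ∈ Finset.Ioc k N,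
      volume (Metric.closedBall (b₀ + ((j : ℝ) - k) * y₀) r \ D) ≤ ENNReal.ofReal (ε * r) := by
    rw [Filter.eventually_all_finset]
    exact fun j hj => hD _ (hmem j hj) ε hε0
  have hρ' : ∀ᶠ r in nhdsWithin (0 : ℝ) (Ioi 0), r ∈ Ioo 0 (((N : ℝ) + 1) * ρ) :=
    Ioo_mem_nhdsGT (by positivity)
  obtain ⟨r, hr, hr0, hr1⟩ := (hall.and hρ').exists
  set η := r / ((N : ℝ) + 1) with hη
  have hN1 : (0 : ℝ) < (N : ℝ) + 1 := by positivity
  have hη0 : 0 < η := by positivity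
  have hrη : r = ((N : ℝ) + 1) * η := by rw [hη]; field_simp
  refine ⟨η, hη0, by rw [hη, div_le_iff₀ hN1]; linarith, fun b hb hfin => ?_⟩
  set Y := {y | |y - y₀| < η ∧ ∀ j ∈ Finset.Ioc k N, b + ((j : ℝ) - k) * y ∈ D} with hY
  let Bd : ℕ → Set ℝ := fun j => {y | |y - y₀| < η ∧ b + ((j : ℝ) - k) * y ∉ D}
  have hcov : Metric.ball y₀ η ⊆ Y ∪ ⋃ j ∈ Finset.Ioc k N, Bd j := by
    intro y hy
    rw [Metric.mem_ball, Real.dist_eq] at hy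
    by_cases h : y ∈ Y
    · exact Or.inl h
    · right
      have : ∃ j ∈ Finset.Ioc k N, b + ((j : ℝ) - k) * y ∉ D := by
        by_contra! hc
        exact h ⟨hy, hc⟩
      obtain ⟨j, hj, hjD⟩ := this
      simp only [mem_iUnion]
      exact ⟨j, hj, hy, hjD⟩
  have hBd : ∀ j ∈ Finset.Ioc k N, volume (Bd j) ≤ ENNReal.ofReal (ε * r) := by
    intro j hj
    have hj' := Finset.mem_Ioc.1 hj
    have hj1 : (1 : ℝ) ≤ (j : ℝ) - k := by
      have : ((k + 1 : ℕ) : ℝ) ≤ j := by exact_mod_cast hj'.1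
      push_cast at this; linarith
    have hj2 : (j : ℝ) - k ≤ N := by
      have : (j : ℝ) ≤ N := by exact_mod_cast hj'.2
      have : (0 : ℝ) ≤ k := by positivity
      linarith
    refine le_trans ?_ (hr j hj)
    calc volume (Bd j) ≤ volume ((fun y => ((j : ℝ) - k) * y) ⁻¹' ((fun z => b + z) ⁻¹'
          (Metric.closedBall (b₀ + ((j : ℝ) - k) * y₀) r \ D))) := by
          apply measure_mono
          rintro y ⟨hy, hyD⟩
          refine ⟨?_, hyD⟩
          rw [Metric.mem_closedBall, Real.dist_eq]
          rw [show b + ((j : ℝ) - k) * y - (b₀ + ((j : ℝ) - k) * y₀)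
            = (b - b₀) + ((j : ℝ) - k) * (y - y₀) by ring]
          refine (abs_add_le _ _).trans ?_
          rw [abs_mul, abs_of_nonneg (by linarith : (0 : ℝ) ≤ (j : ℝ) - k), hrη]
          have : ((j : ℝ) - k) * |y - y₀| ≤ N * η := by
            apply mul_le_mul hj2 hy.le (abs_nonneg _) (by positivity)
          linarith
      _ = ENNReal.ofReal |((j : ℝ) - k)⁻¹| *
          volume (Metric.closedBall (b₀ + ((j : ℝ) - k) * y₀) r \ D) := by
          rw [Real.volume_preimage_mul_left (by linarith), measure_preimage_add]
      _ ≤ 1 * volume (Metric.closedBall (b₀ + ((j : ℝ) - k) * y₀) r \ D) := by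
          gcongr
          rw [← ENNReal.ofReal_one]
          apply ENNReal.ofReal_le_ofReal
          rw [abs_of_nonneg (by apply inv_nonneg.2; linarith)]
          exact inv_le_one_of_one_le₀ hj1
      _ = _ := one_mul _
  have hfinal : ENNReal.ofReal (2 * η) ≤ ENNReal.ofReal η := by
    calc ENNReal.ofReal (2 * η) = volume (Metric.ball y₀ η) := (Real.volume_ball _ _).symm
      _ ≤ volume (Y ∪ ⋃ j ∈ Finset.Ioc k N, Bd j) := measure_mono hcov
      _ ≤ volume Y + volume (⋃ j ∈ Finset.Ioc k N, Bd j) := measure_union_le _ _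
      _ = volume (⋃ j ∈ Finset.Ioc k N, Bd j) := by
          rw [hfin.measure_zero, zero_add]
      _ ≤ ∑ j ∈ Finset.Ioc k N, volume (Bd j) := measure_biUnion_finset_le _ _
      _ ≤ ∑ j ∈ Finset.Ioc k N, ENNReal.ofReal (ε * r) := Finset.sum_le_sum hBd
      _ = ((N - k : ℕ) : ENNReal) * ENNReal.ofReal (ε * r) := by simp
      _ ≤ (N : ENNReal) * ENNReal.ofReal (ε * r) := by
          gcongr; omega
      _ = ENNReal.ofReal (N * (ε * r)) := by
          rw [ENNReal.ofReal_mul (p := (N : ℝ)) (by positivity), ENNReal.ofReal_natCast]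
      _ ≤ ENNReal.ofReal η := by
          apply ENNReal.ofReal_le_ofReal
          rw [hε, hrη]
          rw [show (N : ℝ) * (1 / ((N : ℝ) + 1) ^ 2 * (((N : ℝ) + 1) * η))
            = N / ((N : ℝ) + 1) * η by field_simp]
          have : (N : ℝ) / ((N : ℝ) + 1) ≤ 1 := by rw [div_le_one hN1]; linarith
          nlinarith
  rw [ENNReal.ofReal_le_ofReal_iff hη0.le] at hfinal
  linarith

lemma finite_lines (φ : ℝ → ℝ) (hφ : Continuous φ) (b₀ η : ℝ) (L : Set (ℝ × ℝ)) (hL : L.Finite)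
    (h : ∀ b, |b - b₀| < η → ∃ l ∈ L, φ b = l.1 * b + l.2) :
    (NonlinSet φ ∩ Metric.ball b₀ η).Finite := by
  have hX : (⋃ l ∈ L.offDiag, {b : ℝ | l.1.1 * b + l.1.2 = l.2.1 * b + l.2.2}).Finite := by
    refine Set.Finite.biUnion hL.offDiag ?_
    rintro ⟨⟨p, q⟩, ⟨p', q'⟩⟩ hl
    apply Set.Subsingleton.finite
    intro s hs t ht
    simp only [mem_ofPred_eq] at hs ht
    have hne : (p, q) ≠ (p', q') := hl.2.2
    by_contra hst
    have e : (p - p') * (s - t) = 0 := by linear_combination hs - ht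
    have hp : p = p' := by
      rcases mul_eq_zero.1 e with e | e
      · linarith
      · exact absurd (by linarith) hst
    subst hp
    exact hne (by rw [show q = q' by linarith])
  refine hX.subset ?_
  rintro b ⟨hbE, hb⟩
  rw [Metric.mem_ball, Real.dist_eq] at hb
  by_contra hbX
  apply hbE
  obtain ⟨l, hl, hbl⟩ := h b hb
  have hne : ∀ l' ∈ L, l' ≠ l → φ b ≠ l'.1 * b + l'.2 := by
    intro l' hl' hll e
    apply hbX
    simp only [mem_iUnion]
    exact ⟨(l', l), ⟨hl', hl, hll⟩, by simp only [mem_ofPred_eq]; rw [← e, hbl]⟩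
  have hev : ∀ᶠ u in nhds b, ∀ l' ∈ L, l' ≠ l → φ u ≠ l'.1 * u + l'.2 := by
    rw [Filter.eventually_all_finite hL]
    intro l' hl'
    by_cases hll : l' = l
    · exact Filter.Eventually.of_forall fun u hu => absurd hll hu
    · have c1 : ContinuousAt (fun u => φ u - (l'.1 * u + l'.2)) b := by fun_prop
      filter_upwards [c1.eventually_ne (sub_ne_zero.2 (hne l' hl' hll))] with u hu _
      exact sub_ne_zero.1 hu
  have hev2 : ∀ᶠ u in nhds b, |u - b₀| < η := by
    have c1 : ContinuousAt (fun u => |u - b₀|) b := by fun_prop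
    exact c1.eventually_lt continuousAt_const hb
  obtain ⟨ε, hε, hball⟩ := Metric.eventually_nhds_iff.1 (hev.and hev2)
  refine ⟨ε, hε, l.1, l.2, fun u hu => ?_⟩
  obtain ⟨h1, h2⟩ := hball (y := u) (by rwa [Real.dist_eq])
  obtain ⟨l', hl', e⟩ := h u h2
  by_cases hll : l' = l
  · rw [← hll]; exact e
  · exact absurd e (h1 l' hl' hll)

lemma stage_step (φ : ℝ → ℝ) (hφ : Continuous φ) (N : ℕ) (R : Set ((ℕ → ℝ) × ℝ))
    (hR : R.Finite) (hint : Dense (NonlinSet φ)ᶜ) (D : Set ℝ)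
    (hDE : D ⊆ NonlinSet φ) (hD : FullDensity D) (k : ℕ) (hkN : k + 1 ≤ N) (x₀ y₀ : ℝ)
    (h1 : ∀ j ∈ Finset.Icc 1 k, x₀ + (j : ℝ) * y₀ ∉ NonlinSet φ)
    (h2 : ∀ j ∈ Finset.Ioc k N, x₀ + (j : ℝ) * y₀ ∈ D)
    (h3 : ∀ r ∈ R, (∀ j ∈ Finset.Icc 1 N, k < j → r.1 j = 0) → relSum φ N r.1 x₀ y₀ ≠ r.2) :
    ∃ x y : ℝ, y ≠ 0 ∧ (∀ j ∈ Finset.Icc 1 (k + 1), x + (j : ℝ) * y ∉ NonlinSet φ) ∧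
      (∀ j ∈ Finset.Ioc (k + 1) N, x + (j : ℝ) * y ∈ D) ∧
      ∀ r ∈ R, (∀ j ∈ Finset.Icc 1 N, k + 1 < j → r.1 j = 0) → relSum φ N r.1 x y ≠ r.2 := by
  by_contra hcon
  set K : ℕ := k + 1 with hK
  set b₀ := x₀ + (K : ℝ) * y₀ with hb₀
  have hb₀D : b₀ ∈ D := h2 K (Finset.mem_Ioc.2 ⟨by omega, hkN⟩)
  -- local affine data
  have hloc : ∀ j : ℕ, ∃ p q : ℝ, j ∈ Finset.Icc 1 k →
      ∀ᶠ u in nhds (x₀ + (j : ℝ) * y₀), φ u = p * u + q := by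
    intro j
    by_cases hj : j ∈ Finset.Icc 1 k
    · have := h1 j hj
      simp only [NonlinSet, mem_ofPred_eq, not_not] at this
      obtain ⟨ε, hε, p, q, h⟩ := this
      refine ⟨p, q, fun _ => Metric.eventually_nhds_iff.2 ⟨ε, hε, fun u hu => h u ?_⟩⟩
      rwa [Real.dist_eq] at hu
    · exact ⟨0, 0, fun h => absurd h hj⟩
  choose α β hαβ using hloc
  have hct : ∀ j : ℕ, Filter.Tendsto (fun p : ℝ × ℝ => p.1 + ((j : ℝ) - K) * p.2)
      (nhds (b₀, y₀)) (nhds (x₀ + (j : ℝ) * y₀)) := by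
    intro j
    have : Continuous (fun p : ℝ × ℝ => p.1 + ((j : ℝ) - K) * p.2) := by fun_prop
    have h := this.tendsto (b₀, y₀)
    simp only at h
    rwa [show b₀ + ((j : ℝ) - K) * y₀ = x₀ + (j : ℝ) * y₀ by rw [hb₀]; ring] at h
  have ev1 : ∀ᶠ p : ℝ × ℝ in nhds (b₀, y₀), ∀ j ∈ Finset.Icc 1 k,
      φ (p.1 + ((j : ℝ) - K) * p.2) = α j * (p.1 + ((j : ℝ) - K) * p.2) + β j ∧
      p.1 + ((j : ℝ) - K) * p.2 ∉ NonlinSet φ := by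
    rw [Filter.eventually_all_finset]
    intro j hj
    have e1 := (hct j).eventually (hαβ j hj)
    have e2 := (hct j).eventually ((nonlin_closed φ).isOpen_compl.mem_nhds (h1 j hj))
    filter_upwards [e1, e2] with p hp1 hp2
    exact ⟨hp1, hp2⟩
  have ev2 : ∀ᶠ p : ℝ × ℝ in nhds (b₀, y₀), ∀ r ∈ R,
      (∀ j ∈ Finset.Icc 1 N, k < j → r.1 j = 0) → relSum φ N r.1 (p.1 - K * p.2) p.2 ≠ r.2 := by
    rw [Filter.eventually_all_finite hR]
    intro r hr
    by_cases hc : ∀ j ∈ Finset.Icc 1 N, k < j → r.1 j = 0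
    · have hcont : Continuous (fun p : ℝ × ℝ => relSum φ N r.1 (p.1 - K * p.2) p.2) := by
        unfold relSum; fun_prop
      have hne : relSum φ N r.1 (b₀ - K * y₀) y₀ ≠ r.2 := by
        rw [show b₀ - K * y₀ = x₀ by rw [hb₀]; ring]
        exact h3 r hr hc
      filter_upwards [hcont.continuousAt.eventually_ne (x := (b₀, y₀)) hne] with p hp _
      exact hp
    · exact Filter.Eventually.of_forall fun p hp => absurd hp hc
  obtain ⟨ρ, hρ, hball⟩ := Metric.eventually_nhds_iff.1 (ev1.and ev2)
  obtain ⟨η, hη, hηρ, hinf⟩ := infinite_steps D hD N K b₀ y₀ (by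
    intro j hj
    have hj' := Finset.mem_Ioc.1 hj
    have := h2 j (Finset.mem_Ioc.2 ⟨by omega, hj'.2⟩)
    rwa [show b₀ + ((j : ℝ) - K) * y₀ = x₀ + (j : ℝ) * y₀ by rw [hb₀]; ring]) ρ hρ
  set line : (ℕ → ℝ) × ℝ → ℝ × ℝ := fun r =>
    (-(∑ i ∈ Finset.Icc 1 k, r.1 i * α i) / r.1 K,
      (r.2 - ∑ i ∈ Finset.Icc 1 k, r.1 i * β i) / r.1 K) with hline
  have hmain : ∀ b, |b - b₀| < η → b ∉ NonlinSet φ → ∃ l ∈ line '' R, φ b = l.1 * b + l.2 := by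
    intro b hb hbE
    have hY := (hinf b hb).sdiff (Set.finite_singleton (0 : ℝ))
    set Y := {y | |y - y₀| < η ∧ ∀ j ∈ Finset.Ioc K N, b + ((j : ℝ) - K) * y ∈ D} \ {0} with hYdef
    have hex : ∀ y, ∃ r : (ℕ → ℝ) × ℝ, y ∈ Y → r ∈ R ∧
        (∀ j ∈ Finset.Icc 1 N, K < j → r.1 j = 0) ∧ r.1 K ≠ 0 ∧
        r.1 K * φ b + (∑ i ∈ Finset.Icc 1 k, r.1 i * α i) * b +
          (∑ i ∈ Finset.Icc 1 k, r.1 i * β i) +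
          (∑ i ∈ Finset.Icc 1 k, r.1 i * α i * ((i : ℝ) - K)) * y = r.2 := by
      intro y
      by_cases hy : y ∈ Y
      swap
      · exact ⟨0, fun h => absurd h hy⟩
      obtain ⟨⟨hy1, hy2⟩, hy0⟩ := hy
      obtain ⟨g1, g2⟩ := hball (y := (b, y)) (by
        rw [Prod.dist_eq]; simp only [Real.dist_eq]
        exact max_lt (by linarith) (by linarith))
      simp only at g1 g2
      have hpt : ∀ j : ℕ, b - K * y + j * y = b + ((j : ℝ) - K) * y := fun j => by ring
      have : ∃ r ∈ R, (∀ j ∈ Finset.Icc 1 N, K < j → r.1 j = 0) ∧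
          relSum φ N r.1 (b - K * y) y = r.2 := by
        by_contra! hno
        apply hcon
        refine ⟨b - K * y, y, hy0, ?_, ?_, hno⟩
        · intro j hj
          have hj' := Finset.mem_Icc.1 hj
          rw [hpt]
          by_cases hjK : j = K
          · rw [hjK, sub_self, zero_mul, add_zero]; exact hbE
          · exact (g1 j (Finset.mem_Icc.2 ⟨hj'.1, by omega⟩)).2
        · intro j hj
          rw [hpt]
          exact hy2 j hj
      obtain ⟨r, hr, hr1, hr2⟩ := this
      refine ⟨r, fun _ => ⟨hr, hr1, ?_, ?_⟩⟩
      · intro h0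
        refine g2 r hr (fun j hj hkj => ?_) hr2
        by_cases hjK : j = K
        · rw [hjK]; exact h0
        · exact hr1 j hj (by omega)
      · rw [← hr2, relSum]
        have hsub : ∑ i ∈ Finset.Icc 1 N, r.1 i * φ (b - K * y + i * y) =
            ∑ i ∈ Finset.Icc 1 K, r.1 i * φ (b - K * y + i * y) := by
          symm
          apply Finset.sum_subset (Finset.Icc_subset_Icc le_rfl hkN)
          intro j hj hj'
          have hj1 := Finset.mem_Icc.1 hj
          rw [hr1 j hj (by
            by_contra hlt
            exact hj' (Finset.mem_Icc.2 ⟨hj1.1, by omega⟩)), zero_mul]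
        rw [hsub, hK, Finset.sum_Icc_succ_top (by omega), ← hK]
        rw [hpt K, sub_self, zero_mul, add_zero]
        have : ∑ i ∈ Finset.Icc 1 k, r.1 i * φ (b - K * y + i * y) =
            ∑ i ∈ Finset.Icc 1 k, (r.1 i * α i * b + r.1 i * β i + r.1 i * α i * ((i : ℝ) - K) * y) := by
          refine Finset.sum_congr rfl fun i hi => ?_
          rw [hpt, (g1 i hi).1]; ring
        rw [this, Finset.sum_add_distrib, Finset.sum_add_distrib, Finset.sum_mul, Finset.sum_mul]
        ring
    choose f hf using hex
    obtain ⟨y, hy, y', hy', hne, hff⟩ :=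
      hY.exists_ne_map_eq_of_mapsTo (f := f) (fun y hy => (hf y hy).1) hR
    obtain ⟨hr, -, hrK, e1⟩ := hf y hy
    obtain ⟨-, -, -, e2⟩ := hf y' hy'
    rw [← hff] at e2
    set r := f y
    have hW : (∑ i ∈ Finset.Icc 1 k, r.1 i * α i * ((i : ℝ) - K)) = 0 := by
      have : (∑ i ∈ Finset.Icc 1 k, r.1 i * α i * ((i : ℝ) - K)) * (y - y') = 0 := by
        linear_combination e1 - e2
      exact (mul_eq_zero.1 this).resolve_right (sub_ne_zero.2 hne)
    rw [hW] at e1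
    refine ⟨line r, ⟨r, hr, rfl⟩, ?_⟩
    simp only [hline]
    field_simp
    linear_combination e1
  have hfinL : (line '' R).Finite := hR.image _
  have hclosed : IsClosed {b : ℝ | ∃ l ∈ line '' R, φ b = l.1 * b + l.2} := by
    have : {b : ℝ | ∃ l ∈ line '' R, φ b = l.1 * b + l.2} =
        ⋃ l ∈ line '' R, {b : ℝ | φ b = l.1 * b + l.2} := by
      ext b; simp only [mem_iUnion, mem_ofPred_eq, exists_prop]
    rw [this]
    exact hfinL.isClosed_biUnion fun l _ => isClosed_eq hφ (by fun_prop)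
  have hall : ∀ b, |b - b₀| < η → ∃ l ∈ line '' R, φ b = l.1 * b + l.2 := by
    intro b hb
    have hb' : b ∈ Metric.ball b₀ η := by rwa [Metric.mem_ball, Real.dist_eq]
    have hcl := hint.open_subset_closure_inter Metric.isOpen_ball hb'
    refine closure_minimal ?_ hclosed hcl
    rintro u ⟨hu, huE⟩
    rw [Metric.mem_ball, Real.dist_eq] at hu
    exact hmain u hu huE
  have hfinE := finite_lines φ hφ b₀ η _ hfinL hall
  have hev : ∀ᶠ r in nhdsWithin (0 : ℝ) (Ioi 0), r ∈ Ioo 0 η := Ioo_mem_nhdsGT hη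
  obtain ⟨r, hr1, hr0, hrη⟩ := ((hD b₀ hb₀D 1 one_pos).and hev).exists
  have : ENNReal.ofReal (2 * r) ≤ ENNReal.ofReal (1 * r) := by
    calc ENNReal.ofReal (2 * r) = volume (Metric.closedBall b₀ r) := (Real.volume_closedBall _ _).symm
      _ ≤ volume ((Metric.closedBall b₀ r \ D) ∪ (NonlinSet φ ∩ Metric.ball b₀ η)) := by
        apply measure_mono
        intro u hu
        by_cases huD : u ∈ D
        · exact Or.inr ⟨hDE huD, Metric.closedBall_subset_ball hrη hu⟩
        · exact Or.inl ⟨hu, huD⟩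
      _ ≤ volume (Metric.closedBall b₀ r \ D) + volume (NonlinSet φ ∩ Metric.ball b₀ η) :=
        measure_union_le _ _
      _ ≤ _ := by rw [hfinE.measure_zero, add_zero]; exact hr1
  rw [ENNReal.ofReal_le_ofReal_iff (by linarith)] at this
  linarith

lemma case_dense (φ : ℝ → ℝ) (hφ : Continuous φ) (hE : volume (NonlinSet φ) ≠ 0)
    (N : ℕ) (hN : 1 ≤ N) (R : Set ((ℕ → ℝ) × ℝ))
    (hR : R.Finite) (hgood : ∀ r ∈ R, GoodRel N r.1) (hint : Dense (NonlinSet φ)ᶜ) :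
    ∃ x y : ℝ, y ≠ 0 ∧ ∀ r ∈ R, relSum φ N r.1 x y ≠ r.2 := by
  obtain ⟨D, hDE, ⟨a, ha⟩, hD⟩ := density_set _ (nonlin_closed φ) hE
  have claim : ∀ k ≤ N, ∃ x y : ℝ, (k = 0 ∨ y ≠ 0) ∧
      (∀ j ∈ Finset.Icc 1 k, x + (j : ℝ) * y ∉ NonlinSet φ) ∧
      (∀ j ∈ Finset.Ioc k N, x + (j : ℝ) * y ∈ D) ∧
      ∀ r ∈ R, (∀ j ∈ Finset.Icc 1 N, k < j → r.1 j = 0) → relSum φ N r.1 x y ≠ r.2 := by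
    intro k
    induction k with
    | zero =>
      intro _
      refine ⟨a, 0, Or.inl rfl, by simp, fun j _ => by simpa using ha, ?_⟩
      intro r hr h
      obtain ⟨i, hi, hne⟩ := (hgood r hr).exists_ne
      exact absurd (h i hi (by have := Finset.mem_Icc.1 hi; omega)) hne
    | succ k ih =>
      intro hk
      obtain ⟨x, y, -, h1, h2, h3⟩ := ih (by omega)
      obtain ⟨x', y', h0, h⟩ := stage_step φ hφ N R hR hint D hDE hD k hk x y h1 h2 h3
      exact ⟨x', y', Or.inr h0, h⟩
  obtain ⟨x, y, h0, -, -, h⟩ := claim N le_rfl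
  refine ⟨x, y, h0.resolve_left (by omega), fun r hr => h r hr ?_⟩
  intro j hj hlt
  have := Finset.mem_Icc.1 hj
  omega

lemma core (φ : ℝ → ℝ) (hφ : Continuous φ) (hE : volume (NonlinSet φ) ≠ 0)
    (N : ℕ) (hN : 1 ≤ N) (R : Set ((ℕ → ℝ) × ℝ))
    (hR : R.Finite) (hgood : ∀ r ∈ R, GoodRel N r.1) :
    ∃ x y : ℝ, y ≠ 0 ∧ ∀ r ∈ R, relSum φ N r.1 x y ≠ r.2 := by
  by_cases hint : interior (NonlinSet φ) = ∅
  · exact case_dense φ hφ hE N hN R hR hgood (interior_eq_empty_iff_dense_compl.1 hint)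
  · obtain ⟨t, ht⟩ := Set.nonempty_iff_ne_empty.2 hint
    obtain ⟨ε, hε, hb⟩ := Metric.isOpen_iff.1 isOpen_interior t ht
    rw [Real.ball_eq_Ioo] at hb
    exact case_interior φ hφ N R hR hgood _ _ (by linarith) (hb.trans interior_subset)

/-- Value of a formal element: a term of the progression or a constant. -/
def fval (φ : ℝ → ℝ) (x y : ℝ) : ℕ ⊕ ℝ → ℝ
  | Sum.inl i => φ (x + (i : ℝ) * y)
  | Sum.inr m => m

/-- Coefficient vector of a formal element. -/
def fcoef : ℕ ⊕ ℝ → ℕ → ℝ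
  | Sum.inl i => fun n => if n = i then 1 else 0
  | Sum.inr _ => fun _ => 0

/-- Constant part of a formal element. -/
def fconst : ℕ ⊕ ℝ → ℝ
  | Sum.inl _ => 0
  | Sum.inr m => m

/-- Moment of a formal element. -/
def fmom (e : ℕ) : ℕ ⊕ ℝ → ℝ
  | Sum.inl i => (i : ℝ) ^ e
  | Sum.inr _ => 0

/-- Index of a formal element. -/
def fidx : ℕ ⊕ ℝ → ℕ
  | Sum.inl i => i
  | Sum.inr _ => 0

/-- The admissible formal elements. -/
def felts (N : ℕ) (M : Set ℝ) : Set (ℕ ⊕ ℝ) :=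
  (Sum.inl '' (Finset.Icc 1 N : Set ℕ)) ∪ (Sum.inr '' M)

def frel (p q r s : ℕ ⊕ ℝ) : (ℕ → ℝ) × ℝ :=
  (fun n => fcoef p n + fcoef q n - fcoef r n - fcoef s n,
    -(fconst p + fconst q - fconst r - fconst s))

lemma inl_mem_felts {N : ℕ} {M : Set ℝ} {i : ℕ} (h : Sum.inl i ∈ felts N M) :
    i ∈ Finset.Icc 1 N := by
  rcases h with ⟨j, hj, e⟩ | ⟨j, hj, e⟩
  · cases e; exact_mod_cast hj
  · cases e

lemma inr_mem_felts {N : ℕ} {M : Set ℝ} {m : ℝ} (h : Sum.inr m ∈ felts N M) : m ∈ M := by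
  rcases h with ⟨j, hj, e⟩ | ⟨j, hj, e⟩
  · cases e
  · cases e; exact hj

lemma fcoef_sum {N : ℕ} {M : Set ℝ} {p : ℕ ⊕ ℝ} (hp : p ∈ felts N M) (g : ℕ → ℝ) :
    ∑ i ∈ Finset.Icc 1 N, fcoef p i * g i = Sum.elim g (fun _ => 0) p := by
  rcases p with i | m
  · have := inl_mem_felts hp
    simp only [fcoef, ite_mul, one_mul, zero_mul, Finset.sum_ite_eq', this, if_true, Sum.elim_inl]
  · simp [fcoef]

lemma frel_sum {N : ℕ} {M : Set ℝ} {p q r s : ℕ ⊕ ℝ} (hp : p ∈ felts N M) (hq : q ∈ felts N M)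
    (hr : r ∈ felts N M) (hs : s ∈ felts N M) (g : ℕ → ℝ) :
    ∑ i ∈ Finset.Icc 1 N, (frel p q r s).1 i * g i = Sum.elim g (fun _ => 0) p +
      Sum.elim g (fun _ => 0) q - Sum.elim g (fun _ => 0) r - Sum.elim g (fun _ => 0) s := by
  rw [← fcoef_sum hp, ← fcoef_sum hq, ← fcoef_sum hr, ← fcoef_sum hs]
  rw [← Finset.sum_add_distrib, ← Finset.sum_sub_distrib, ← Finset.sum_sub_distrib]
  refine Finset.sum_congr rfl fun i _ => ?_
  simp only [frel]; ring

lemma frel_mom {N : ℕ} {M : Set ℝ} {p q r s : ℕ ⊕ ℝ} (hp : p ∈ felts N M) (hq : q ∈ felts N M)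
    (hr : r ∈ felts N M) (hs : s ∈ felts N M) (e : ℕ) :
    ∑ i ∈ Finset.Icc 1 N, (frel p q r s).1 i * (i : ℝ) ^ e =
      fmom e p + fmom e q - fmom e r - fmom e s := by
  rw [frel_sum hp hq hr hs (fun i => (i : ℝ) ^ e)]
  rcases p with _ | _ <;> rcases q with _ | _ <;> rcases r with _ | _ <;> rcases s with _ | _ <;> rfl

lemma frel_val {N : ℕ} {M : Set ℝ} {p q r s : ℕ ⊕ ℝ} (hp : p ∈ felts N M) (hq : q ∈ felts N M)
    (hr : r ∈ felts N M) (hs : s ∈ felts N M) (φ : ℝ → ℝ) (x y : ℝ)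
    (h : fval φ x y p + fval φ x y q = fval φ x y r + fval φ x y s) :
    relSum φ N (frel p q r s).1 x y = (frel p q r s).2 := by
  have hf : ∀ p : ℕ ⊕ ℝ, Sum.elim (fun i : ℕ => φ (x + (i : ℝ) * y)) (fun _ => 0) p =
      fval φ x y p - fconst p := by
    intro p
    rcases p with _ | _ <;> simp [fval, fconst]
  rw [relSum, frel_sum hp hq hr hs (fun i => φ (x + (i : ℝ) * y)), hf, hf, hf, hf]
  simp only [frel]
  linarith

lemma frel_good {N : ℕ} {M : Set ℝ} {p q r s : ℕ ⊕ ℝ} (hp : p ∈ felts N M) (hq : q ∈ felts N M)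
    (hr : r ∈ felts N M) (hs : s ∈ felts N M)
    (h : fmom 0 p + fmom 0 q - fmom 0 r - fmom 0 s ≠ 0 ∨
      fmom 1 p + fmom 1 q - fmom 1 r - fmom 1 s ≠ 0 ∨
      fmom 2 p + fmom 2 q - fmom 2 r - fmom 2 s ≠ 0) : GoodRel N (frel p q r s).1 := by
  refine ⟨?_, fidx p, fidx q, fidx r, fidx s, ?_⟩
  · rw [← frel_mom hp hq hr hs, ← frel_mom hp hq hr hs, ← frel_mom hp hq hr hs] at h
    simpa only [pow_zero, mul_one, pow_one] using h
  · intro i hi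
    by_contra! hcon
    apply hi
    have hz : ∀ p : ℕ ⊕ ℝ, i ≠ fidx p → fcoef p i = 0 := by
      intro p hp
      rcases p with j | m
      · simp only [fidx] at hp
        simp [fcoef, hp]
      · rfl
    simp only [frel, hz p hcon.1, hz q hcon.2.1, hz r hcon.2.2.1, hz s hcon.2.2.2]
    ring

theorem accumulation_step (φ : ℝ → ℝ) (hφ : Continuous φ)
    (hE : volume (NonlinSet φ) ≠ 0) (N : ℕ) (hN : 4 ≤ N)
    (M : Set ℝ) (hM : M.Finite) (hMdsp : DistinctSumsOfPairs M) :
    ∃ x y : ℝ, y ≠ 0 ∧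
      (Set.InjOn φ {t : ℝ | ∃ k ∈ Finset.Icc 1 N, t = x + (k : ℝ) * y}) ∧
      (φ '' {t : ℝ | ∃ k ∈ Finset.Icc 1 N, t = x + (k : ℝ) * y}) ∩ M = ∅ ∧
      DistinctSumsOfPairs
        ((φ '' {t : ℝ | ∃ k ∈ Finset.Icc 1 N, t = x + (k : ℝ) * y}) ∪ M) := by
  have hT : (felts N M).Finite :=
    ((Finset.finite_toSet _).image _).union (hM.image _)
  set R : Set ((ℕ → ℝ) × ℝ) :=
    ((fun z : ((ℕ ⊕ ℝ) × (ℕ ⊕ ℝ)) × ((ℕ ⊕ ℝ) × (ℕ ⊕ ℝ)) => frel z.1.1 z.1.2 z.2.1 z.2.2) ''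
      ((felts N M ×ˢ felts N M) ×ˢ (felts N M ×ˢ felts N M))) ∩ {r | GoodRel N r.1} with hRdef
  have hR : R.Finite := (((hT.prod hT).prod (hT.prod hT)).image _).inter_of_left _
  obtain ⟨x, y, hy, hxy⟩ := core φ hφ hE N (by omega) R hR (fun r hr => hr.2)
  have key : ∀ p ∈ felts N M, ∀ q ∈ felts N M, ∀ r ∈ felts N M, ∀ s ∈ felts N M,
      fval φ x y p + fval φ x y q = fval φ x y r + fval φ x y s →
      fmom 0 p + fmom 0 q - fmom 0 r - fmom 0 s = 0 ∧
      fmom 1 p + fmom 1 q - fmom 1 r - fmom 1 s = 0 ∧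
      fmom 2 p + fmom 2 q - fmom 2 r - fmom 2 s = 0 := by
    intro p hp q hq r hr s hs h
    by_contra hcon
    have hg := frel_good hp hq hr hs (by tauto)
    exact hxy (frel p q r s) ⟨⟨((p, q), (r, s)), ⟨⟨hp, hq⟩, ⟨hr, hs⟩⟩, rfl⟩, hg⟩
      (frel_val hp hq hr hs φ x y h)
  have memL : ∀ k ∈ Finset.Icc 1 N, Sum.inl k ∈ felts N M := fun k hk =>
    Or.inl ⟨k, by exact_mod_cast hk, rfl⟩
  have memR : ∀ m ∈ M, Sum.inr m ∈ felts N M := fun m hm => Or.inr ⟨m, hm, rfl⟩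
  refine ⟨x, y, hy, ?_, ?_, ?_⟩
  · rintro t ⟨i, hi, rfl⟩ u ⟨j, hj, rfl⟩ e
    have := (key _ (memL i hi) _ (memL i hi) _ (memL j hj) _ (memL j hj) (by
      simp only [fval]; rw [e])).2.1
    simp only [fmom, pow_one] at this
    rw [show (i : ℝ) = j by linarith]
  · rw [Set.eq_empty_iff_forall_notMem]
    rintro z ⟨⟨t, ⟨i, hi, rfl⟩, rfl⟩, hz⟩
    have := (key _ (memL i hi) _ (memL i hi) _ (memR _ hz) _ (memR _ hz) (by
      simp only [fval])).1
    simp only [fmom, pow_zero] at this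
    norm_num at this
  · have hrep : ∀ l ∈ ((φ '' {t : ℝ | ∃ k ∈ Finset.Icc 1 N, t = x + (k : ℝ) * y}) ∪ M),
        ∃ p ∈ felts N M, fval φ x y p = l := by
      rintro l (⟨t, ⟨i, hi, rfl⟩, rfl⟩ | hl)
      · exact ⟨_, memL i hi, rfl⟩
      · exact ⟨_, memR l hl, rfl⟩
    intro l₁ h1 l₂ h2 l₃ h3 l₄ h4 h
    obtain ⟨p, hp, rfl⟩ := hrep l₁ h1
    obtain ⟨q, hq, rfl⟩ := hrep l₂ h2
    obtain ⟨r, hr, rfl⟩ := hrep l₃ h3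
    obtain ⟨s, hs, rfl⟩ := hrep l₄ h4
    obtain ⟨k0, k1, k2⟩ := key p hp q hq r hr s hs h
    rcases p with i | a <;> rcases q with j | b <;> rcases r with k | c <;> rcases s with l | d <;>
      simp only [fmom, pow_zero, pow_one, fval] at k0 k1 k2 h ⊢ <;> norm_num at k0
    · have e : ((i : ℝ) - k) * (i - l) = 0 := by
        have hj : (j : ℝ) = k + l - i := by linarith
        rw [hj] at k2
        linear_combination k2 / 2
      rcases mul_eq_zero.1 e with e | e
      · left
        rw [show (i : ℝ) = k by linarith, show (j : ℝ) = l by linarith]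
        exact ⟨rfl, rfl⟩
      · right
        rw [show (i : ℝ) = l by linarith, show (j : ℝ) = k by linarith]
        exact ⟨rfl, rfl⟩
    · left
      have e : (i : ℝ) = k := by linarith
      rw [e] at h ⊢
      exact ⟨rfl, by linarith⟩
    · right
      have e : (i : ℝ) = l := by linarith
      rw [e] at h ⊢
      exact ⟨rfl, by linarith⟩
    · right
      have e : (j : ℝ) = k := by linarith
      rw [e] at h ⊢
      exact ⟨by linarith, rfl⟩
    · left
      have e : (j : ℝ) = l := by linarith
      rw [e] at h ⊢
      exact ⟨by linarith, rfl⟩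
    · exact hMdsp a (inr_mem_felts hp) b (inr_mem_felts hq) c (inr_mem_felts hr) d
        (inr_mem_felts hs) h
end

section
/- Let E ⊆ ℤ be a set with distinct sums of pairs, let λ1, ..., λn ∈ E be pairwise distinct integers, let c1, ..., cn be complex numbers, and let f(t) = Σ_{j=1}^{n} c_j·e^{i·λ_j·t} for t ∈ ℝ. Then ((1/(2π))·∫_{0}^{2π} |f(t)|⁴ dt)^{1/4} ≤ 2^{1/4}·((1/(2π))·∫_{0}^{2π} |f(t)|² dt)^{1/2}; that is, E is a set of type Λ(4) with constant 2^{1/4}. -/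
open Filter Complex Real

/-- A set `E ⊆ ℤ` has distinct sums of pairs. -/
def DistinctSumsOfPairsZ (E : Set ℤ) : Prop :=
  ∀ l₁ ∈ E, ∀ l₂ ∈ E, ∀ l₃ ∈ E, ∀ l₄ ∈ E,
    l₁ + l₂ = l₃ + l₄ → (l₁ = l₃ ∧ l₂ = l₄) ∨ (l₁ = l₄ ∧ l₂ = l₃)

lemma dsp_integral_exp (k : ℤ) :
    ∫ t in (0 : ℝ)..(2 * π), Complex.exp (Complex.I * (k : ℂ) * t) =
      if k = 0 then ((2 * π : ℝ) : ℂ) else 0 := by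
  split_ifs with h
  · subst h; simp
  · have hc : Complex.I * (k : ℂ) ≠ 0 := by simp [h]
    rw [integral_exp_mul_complex hc]
    have : Complex.exp (Complex.I * (k : ℂ) * ((2 * π : ℝ) : ℂ)) = 1 := by
      rw [Complex.exp_eq_one_iff]
      exact ⟨k, by push_cast; ring⟩
    rw [this]; simp

lemma dsp_parseval {ι : Type} [Fintype ι] (m : ι → ℤ) (a : ι → ℂ) :
    (((1 / (2 * π)) * ∫ t in (0 : ℝ)..(2 * π),
      ‖∑ i, a i * Complex.exp (Complex.I * (m i : ℂ) * t)‖ ^ 2 : ℝ) : ℂ) =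
      ∑ i, ∑ j, if m i = m j then a i * (starRingEnd ℂ) (a j) else 0 := by
  have key : ∀ t : ℝ, (((‖∑ i, a i * Complex.exp (Complex.I * (m i : ℂ) * t)‖ ^ 2 : ℝ)) : ℂ) =
      ∑ i, ∑ j, a i * (starRingEnd ℂ) (a j) *
        Complex.exp (Complex.I * ((m i - m j : ℤ) : ℂ) * t) := by
    intro t
    push_cast
    rw [← Complex.mul_conj', map_sum, Finset.sum_mul_sum]
    refine Finset.sum_congr rfl fun i _ => Finset.sum_congr rfl fun j _ => ?_
    rw [map_mul, ← Complex.exp_conj]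
    simp only [map_mul, Complex.conj_I, Complex.conj_ofReal, map_intCast]
    rw [mul_mul_mul_comm, ← Complex.exp_add]
    congr 2
    ring
  rw [Complex.ofReal_mul, ← intervalIntegral.integral_ofReal]
  simp_rw [key]
  rw [intervalIntegral.integral_finset_sum
    (fun i _ => Continuous.intervalIntegrable (by fun_prop) _ _), Finset.mul_sum]
  refine Finset.sum_congr rfl fun i _ => ?_
  rw [intervalIntegral.integral_finset_sum
    (fun i _ => Continuous.intervalIntegrable (by fun_prop) _ _), Finset.mul_sum]
  refine Finset.sum_congr rfl fun j _ => ?_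
  rw [intervalIntegral.integral_const_mul, dsp_integral_exp]
  have hpi : (π : ℂ) ≠ 0 := by exact_mod_cast Real.pi_ne_zero
  simp only [sub_eq_zero]
  split_ifs
  · push_cast; field_simp
  · simp

theorem dsp_lambda4 (E : Set ℤ) (hE : DistinctSumsOfPairsZ E)
    (n : ℕ) (l : Fin n → ℤ) (hl : Function.Injective l) (hlE : ∀ j, l j ∈ E)
    (c : Fin n → ℂ) (f : ℝ → ℂ)
    (hf : ∀ t : ℝ, f t = ∑ j : Fin n, c j * Complex.exp (Complex.I * (l j : ℂ) * t)) :
    ((1 / (2 * π)) * ∫ t in (0 : ℝ)..(2 * π), ‖f t‖ ^ 4) ^ ((1 : ℝ) / 4) ≤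
      2 ^ ((1 : ℝ) / 4) *
        ((1 / (2 * π)) * ∫ t in (0 : ℝ)..(2 * π), ‖f t‖ ^ 2) ^ ((1 : ℝ) / 2) := by
  have h2 : (1 / (2 * π)) * ∫ t in (0 : ℝ)..(2 * π), ‖f t‖ ^ 2 = ∑ j, ‖c j‖ ^ 2 := by
    have := dsp_parseval l c
    simp_rw [← hf, hl.eq_iff] at this
    simp only [Finset.sum_ite_eq, Finset.mem_univ, if_true, Complex.mul_conj'] at this
    exact_mod_cast this
  have h4 : (1 / (2 * π)) * ∫ t in (0 : ℝ)..(2 * π), ‖f t‖ ^ 4 ≤ 2 * (∑ j, ‖c j‖ ^ 2) ^ 2 := by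
    have hsq : ∀ t : ℝ, ‖f t‖ ^ 4 = ‖∑ p : Fin n × Fin n, c p.1 * c p.2 *
        Complex.exp (Complex.I * ((l p.1 + l p.2 : ℤ) : ℂ) * t)‖ ^ 2 := by
      intro t
      have : ∑ p : Fin n × Fin n, c p.1 * c p.2 *
        Complex.exp (Complex.I * ((l p.1 + l p.2 : ℤ) : ℂ) * t) = f t * f t := by
        rw [hf, Finset.sum_mul_sum, Fintype.sum_prod_type]
        refine Finset.sum_congr rfl fun i _ => Finset.sum_congr rfl fun j _ => ?_
        rw [mul_mul_mul_comm, ← Complex.exp_add]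
        congr 2
        push_cast
        ring
      rw [this, norm_mul]; ring
    have hP := dsp_parseval (fun p : Fin n × Fin n => l p.1 + l p.2) (fun p => c p.1 * c p.2)
    simp_rw [← hsq] at hP
    refine (le_abs_self _).trans ?_
    rw [← Real.norm_eq_abs, ← Complex.norm_real, hP]
    have hS : 2 * (∑ j, ‖c j‖ ^ 2) ^ 2 =
        ∑ p : Fin n × Fin n, 2 * ‖c p.1 * c p.2‖ ^ 2 := by
      rw [← Finset.mul_sum, Fintype.sum_prod_type, sq, Finset.sum_mul_sum]
      simp_rw [norm_mul, mul_pow]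
    rw [hS]
    refine (norm_sum_le _ _).trans (Finset.sum_le_sum fun p _ => ?_)
    refine (norm_sum_le _ _).trans ?_
    calc _ ≤ ∑ q : Fin n × Fin n, ((if p = q then ‖c p.1 * c p.2‖ ^ 2 else 0) +
              (if p.swap = q then ‖c p.1 * c p.2‖ ^ 2 else 0)) := by
          refine Finset.sum_le_sum fun q _ => ?_
          have e1 : 0 ≤ (if p = q then ‖c p.1 * c p.2‖ ^ 2 else 0) := by
            split_ifs <;> positivity
          have e2 : 0 ≤ (if p.swap = q then ‖c p.1 * c p.2‖ ^ 2 else 0) := by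
            split_ifs <;> positivity
          by_cases h : l p.1 + l p.2 = l q.1 + l q.2
          · rw [if_pos h]
            rcases hE _ (hlE _) _ (hlE _) _ (hlE _) _ (hlE _) h with ⟨a, b⟩ | ⟨a, b⟩
            · have hq : p = q := Prod.ext (hl a) (hl b)
              rw [if_pos hq, ← hq, norm_mul, RCLike.norm_conj, ← sq]
              rw [← hq] at e2
              linarith
            · have hq : p.swap = q := Prod.ext (hl b) (hl a)
              rw [if_pos hq, ← hq, norm_mul, RCLike.norm_conj, Prod.fst_swap, Prod.snd_swap,
                mul_comm (c p.2), ← sq]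
              rw [← hq] at e1
              linarith
          · rw [if_neg h, norm_zero]; positivity
      _ = _ := by
          rw [Finset.sum_add_distrib]
          simp
          ring
  rw [h2]
  have hS0 : 0 ≤ ∑ j, ‖c j‖ ^ 2 := by positivity
  have hA0 : 0 ≤ (1 / (2 * π)) * ∫ t in (0 : ℝ)..(2 * π), ‖f t‖ ^ 4 :=
    mul_nonneg (by positivity)
      (intervalIntegral.integral_nonneg (by positivity) fun _ _ => by positivity)
  refine (Real.rpow_le_rpow hA0 h4 (by norm_num)).trans (le_of_eq ?_)
  rw [Real.mul_rpow (by norm_num) (by positivity), ← Real.rpow_natCast, ← Real.rpow_mul hS0]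
  norm_num
end
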